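/- Measurable selection for optional sets with auxiliary parameter: let P̄ be a probability on (Ω̄, F̄), (E, ℰ) a Lusin (standard Borel) measurable space, and A ⊆ ℝ₊ × Ω̄ × E a set measurable with respect to Ō ⊗ ℰ, where Ō is the optional σ-field of F̄. Then for every ε > 0 there exists an F̄-stopping time τ such that P̄[τ < ∞] ≥ P̄[Π₂(A)] − ε and (τ(ω̄), ω̄) ∈ Π₁₂(A) whenever τ(ω̄) < ∞, where Π₂(A) := {ω̄ : ∃(t,e), (t,ω̄,e) ∈ A} and Π₁₂(A) := {(t,ω̄) : ∃e, (t,ω̄,e) ∈ A}. -/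

import Mathlib

open MeasureTheory MeasurableSpace
open scoped NNReal ENNReal

/-- Paths on `ℝ₊`. -/
abbrev RPath : Type := ℝ≥0 → ℝ

/-- The enlarged space `Ω̄ = Ω × ℝ₊`. -/
abbrev OmegaBar : Type := RPath × ℝ≥0

/-- The enlarged canonical filtration `F̄_t = σ(B_u, u ≤ t) ∨ σ({T ≤ u}, u ≤ t)`. -/
def Fbar (t : ℝ≥0) : MeasurableSpace OmegaBar :=
  (⨆ u ∈ Set.Iic t, MeasurableSpace.comap (fun x : OmegaBar => x.1 u)
      (inferInstance : MeasurableSpace ℝ)) ⊔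
    MeasurableSpace.generateFrom {A | ∃ u ≤ t, A = {x : OmegaBar | x.2 ≤ u}}

/-- An `F̄`-stopping time with values in `[0,∞]`. -/
def IsFbarStopping (τ : OmegaBar → ℝ≥0∞) : Prop :=
  ∀ t : ℝ≥0, MeasurableSet[Fbar t] {x : OmegaBar | τ x ≤ t}

/-- The optional σ-field `Ō` on `ℝ₊ × Ω̄`, generated by the stochastic intervals
`[[σ, τ[[` of `F̄`-stopping times. -/
def OptionalSF : MeasurableSpace (ℝ≥0 × OmegaBar) :=
  MeasurableSpace.generateFrom
    {s | ∃ σ τ : OmegaBar → ℝ≥0∞, IsFbarStopping σ ∧ IsFbarStopping τ ∧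
      s = {p : ℝ≥0 × OmegaBar | σ p.2 ≤ (p.1 : ℝ≥0∞) ∧ (p.1 : ℝ≥0∞) < τ p.2}}

open Set Topology

/-- The bounded boxes of the Baire space are compact. -/
theorem isCompact_ofPred_forall_le (m : ℕ → ℕ) : IsCompact {x : ℕ → ℕ | ∀ i, x i ≤ m i} := by
  convert isCompact_univ_pi fun i => (finite_Iic (m i)).isCompact using 1
  ext x; simp [Pi.le_def]

/-- A neighbourhood of the compact box `{x | ∀ i, x i ≤ m i}` of the Baire space contains
all sequences satisfying finitely many of the constraints. -/
theorem exists_forall_lt_le_imp_mem_of_isOpen {m : ℕ → ℕ} {V : Set (ℕ → ℕ)} (hV : IsOpen V)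
    (hmV : {x : ℕ → ℕ | ∀ i, x i ≤ m i} ⊆ V) :
    ∃ k, ∀ x : ℕ → ℕ, (∀ i < k, x i ≤ m i) → x ∈ V := by
  by_contra! h
  choose z hz hzV using h
  obtain ⟨x, hx, φ, hφ, hlim⟩ := (isCompact_ofPred_forall_le m).tendsto_subseq
    (x := fun k i => min (z k i) (m i)) fun k i => min_le_right _ _
  have hzlim : Filter.Tendsto (fun k => z (φ k)) Filter.atTop (𝓝 x) := by
    rw [tendsto_pi_nhds] at hlim ⊢
    intro i
    refine (hlim i).congr' ?_
    filter_upwards [Filter.eventually_gt_atTop i] with k hk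
    exact min_eq_left (hz _ i (hk.trans_le (hφ.id_le k)))
  obtain ⟨k, hk⟩ := (hzlim.eventually (hV.mem_nhds (hmV hx))).exists
  exact hzV _ hk

/-- Capacitability of continuous images of the Baire space. -/
theorem exists_isCompact_le_measure_image {Y : Type*} [TopologicalSpace Y] [MeasurableSpace Y]
    (Q : Measure Y) [Q.OuterRegular] {p : (ℕ → ℕ) → Y} (hp : Continuous p) {c : ℝ≥0∞}
    (hc : c < Q (range p)) : ∃ L : Set (ℕ → ℕ), IsCompact L ∧ c ≤ Q (p '' L) := by
  have step : ∀ (n : ℕ) (S : {S : Set (ℕ → ℕ) // c < Q (p '' S)}),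
      ∃ j, c < Q (p '' (S.1 ∩ {x | x n ≤ j})) := by
    rintro n ⟨S, hS⟩
    have hmono : Monotone fun j => p '' (S ∩ {x : ℕ → ℕ | x n ≤ j}) := by
      intro a b hab
      refine image_mono (inter_subset_inter_right _ fun x (hx : x n ≤ a) => hx.trans hab)
    have hU : p '' S = ⋃ j, p '' (S ∩ {x : ℕ → ℕ | x n ≤ j}) := by
      rw [← image_iUnion, ← inter_iUnion]
      congr 1
      refine (inter_eq_left.2 fun x _ => mem_iUnion.2 ⟨x n, le_refl (x n)⟩).symm
    rw [hU, hmono.measure_iUnion] at hS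
    exact lt_iSup_iff.1 hS
  choose j hj using step
  let T : ℕ → {S : Set (ℕ → ℕ) // c < Q (p '' S)} := fun k =>
    Nat.rec ⟨univ, by rwa [image_univ]⟩ (fun n S => ⟨S.1 ∩ {x | x n ≤ j n S}, hj n S⟩) k
  let m : ℕ → ℕ := fun n => j n (T n)
  have hT : ∀ k x, x ∈ (T k).1 ↔ ∀ i < k, x i ≤ m i := by
    intro k
    induction k with
    | zero => intro x; simp [T]
    | succ k ih =>
      intro x
      have : x ∈ (T (k + 1)).1 ↔ x ∈ (T k).1 ∧ x k ≤ m k := Iff.rfl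
      rw [this, ih]
      exact Nat.forall_lt_succ_right.symm
  refine ⟨{x | ∀ i, x i ≤ m i}, isCompact_ofPred_forall_le m, ?_⟩
  by_contra! hlt
  obtain ⟨U, hLU, hU, hUc⟩ := Set.exists_isOpen_lt_of_lt _ _ hlt
  obtain ⟨k, hk⟩ := exists_forall_lt_le_imp_mem_of_isOpen (hU.preimage hp) (image_subset_iff.1 hLU)
  refine ((T k).2.trans_le (measure_mono ?_)).not_gt hUc
  rintro _ ⟨x, hx, rfl⟩
  exact hk x ((hT k x).1 hx)

/-- A measurable subset of a product depends on the first coordinate only through a measurable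
map to the Cantor space. -/
theorem MeasurableSet.exists_preimage_prodMap {Y Z : Type*} [MeasurableSpace Y]
    [MeasurableSpace Z] {A : Set (Y × Z)} (hA : MeasurableSet A) :
    ∃ (g : Y → ℕ → Bool) (A' : Set ((ℕ → Bool) × Z)), Measurable g ∧ MeasurableSet A' ∧
      Prod.map g id ⁻¹' A' = A := by
  classical
  rw [← generateFrom_prod] at hA
  induction A, hA using generateFrom_induction with
  | hC t ht =>
    obtain ⟨u, hu, v, hv, rfl⟩ := ht
    refine ⟨fun y _ => decide (y ∈ u), {w | w 0 = true} ×ˢ v, ?_, ?_, ?_⟩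
    · refine measurable_pi_lambda _ fun _ => measurable_to_bool ?_
      simpa [preimage] using hu
    · exact ((measurableSet_singleton true).preimage (measurable_pi_apply 0)).prod hv
    · ext ⟨y, z⟩; simp
  | empty => exact ⟨fun _ _ => true, ∅, measurable_const, .empty, rfl⟩
  | compl t _ ih =>
    obtain ⟨g, A', hg, hA', rfl⟩ := ih
    exact ⟨g, A'ᶜ, hg, hA'.compl, rfl⟩
  | iUnion s _ ih =>
    choose g A' hg hA' h using ih
    let r : ℕ → (ℕ → Bool) → ℕ → Bool := fun n w k => w (Nat.pair n k)
    have hr : ∀ n, Measurable (r n) := fun n =>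
      measurable_pi_lambda _ fun k => measurable_pi_apply _
    refine ⟨fun y k => g k.unpair.1 y k.unpair.2, ⋃ n, Prod.map (r n) id ⁻¹' A' n, ?_, ?_, ?_⟩
    · exact measurable_pi_lambda _ fun k => (measurable_pi_apply _).comp (hg _)
    · exact .iUnion fun n => (hA' n).preimage ((hr n).prodMap measurable_id)
    · rw [preimage_iUnion]
      refine iUnion_congr fun n => ?_
      rw [← h n]
      ext ⟨y, z⟩
      simp [r]

/-- Compact inner approximation of the projection of a measurable subset of a product. -/
theorem MeasurableSet.exists_isCompact_measure_proj_le {Y Z : Type*} [MeasurableSpace Y]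
    [MeasurableSpace Z] [TopologicalSpace Z] [PolishSpace Z] [BorelSpace Z]
    (Q : Measure Y) [IsFiniteMeasure Q] {A : Set (Y × Z)} (hA : MeasurableSet A)
    {ε : ℝ≥0∞} (hε : ε ≠ 0) :
    ∃ (g : Y → ℕ → Bool) (K : Set ((ℕ → Bool) × Z)), Measurable g ∧ IsCompact K ∧
      (∀ y z, (g y, z) ∈ K → (y, z) ∈ A) ∧
      Q {y | ∃ z, (y, z) ∈ A} ≤ Q {y | ∃ z, (g y, z) ∈ K} + ε := by
  obtain ⟨g, A', hg, hA', rfl⟩ := hA.exists_preimage_prodMap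
  rcases eq_or_ne (Q {y | ∃ z, (y, z) ∈ Prod.map g id ⁻¹' A'}) 0 with h0 | h0
  · exact ⟨g, ∅, hg, isCompact_empty, by simp, h0.trans_le zero_le⟩
  have : PolishSpace (ℕ → Bool) := by
    let := TopologicalSpace.metrizableSpaceMetric (ℕ → Bool)
    infer_instance
  have han : AnalyticSet A' := hA'.analyticSet
  rw [AnalyticSet] at han
  obtain rfl | ⟨f, hf, rfl⟩ := han
  · simp at h0
  have hsub : {y | ∃ z, (y, z) ∈ Prod.map g id ⁻¹' range f} = g ⁻¹' range (fun x => (f x).1) := by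
    ext y
    constructor
    · rintro ⟨z, x, hx⟩
      exact ⟨x, by simp [hx]⟩
    · rintro ⟨x, hx⟩
      exact ⟨(f x).2, x, by ext <;> simp [← hx]⟩
  have hlt : Q {y | ∃ z, (y, z) ∈ Prod.map g id ⁻¹' range f} - ε
      < Q.map g (range (fun x => (f x).1)) := by
    refine (ENNReal.sub_lt_self (measure_ne_top _ _) h0 hε).trans_le ?_
    rw [hsub]
    exact Measure.le_map_apply hg.aemeasurable _
  obtain ⟨L, hL, hLc⟩ := exists_isCompact_le_measure_image (Q.map g) (continuous_fst.comp hf) hlt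
  refine ⟨g, f '' L, hg, hL.image hf, fun y z h => image_subset_range _ _ h, ?_⟩
  rw [← tsub_le_iff_right]
  refine hLc.trans ?_
  rw [Measure.map_apply hg (hL.image (continuous_fst.comp hf)).measurableSet]
  refine measure_mono ?_
  rintro y ⟨x, hx, hxy⟩
  exact ⟨(f x).2, x, hx, by ext <;> simp [← hxy]⟩

/-- Measurable inner approximation of the projection of a measurable subset of a product. -/
theorem MeasurableSet.exists_measurableSet_measure_proj_le {Ω Y Z : Type*} [MeasurableSpace Ω]
    [MeasurableSpace Y] [MeasurableSpace Z] [StandardBorelSpace Z]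
    (P : Measure Ω) [IsFiniteMeasure P] {φ : Ω → Y} (hφ : Measurable φ)
    {A : Set (Y × Z)} (hA : MeasurableSet A) {ε : ℝ≥0∞} (hε : ε ≠ 0) :
    ∃ C : Set Y, MeasurableSet C ∧ (∀ y ∈ C, ∃ z, (y, z) ∈ A) ∧
      P {x | ∃ z, (φ x, z) ∈ A} ≤ P (φ ⁻¹' C) + ε := by
  let := upgradeStandardBorel Z
  obtain ⟨g, K, hg, hK, hKA, hle⟩ := hA.exists_isCompact_measure_proj_le (P.map φ) hε
  have hC : MeasurableSet {y | ∃ z, (g y, z) ∈ K} := by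
    convert (hK.image continuous_fst).measurableSet.preimage hg using 1
    ext y; simp
  refine ⟨_, hC, fun y ⟨z, hz⟩ => ⟨z, hKA y z hz⟩, ?_⟩
  rw [Measure.map_apply hφ hC] at hle
  exact (Measure.le_map_apply hφ.aemeasurable {y | ∃ z, (y, z) ∈ A}).trans hle

/-- Measurable section of a measurable set in the time coordinate. -/
theorem MeasurableSet.exists_measurable_section {Y E : Type*} [MeasurableSpace Y]
    [MeasurableSpace E] [StandardBorelSpace E] (Q : Measure Y) [IsFiniteMeasure Q]
    {A : Set (Y × (ℝ≥0 × E))} (hA : MeasurableSet A) {ε : ℝ≥0∞} (hε : ε ≠ 0) :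
    ∃ (C : Set Y) (R : Y → ℝ≥0), MeasurableSet C ∧ Measurable R ∧
      (∀ y ∈ C, ∃ e, (y, (R y, e)) ∈ A) ∧ Q {y | ∃ z, (y, z) ∈ A} ≤ Q C + ε := by
  let := upgradeStandardBorel E
  obtain ⟨g, K, hg, hK, hKA, hle⟩ := hA.exists_isCompact_measure_proj_le Q hε
  have hproj : ∀ K' : Set ((ℕ → Bool) × (ℝ≥0 × E)), IsCompact K' →
      MeasurableSet {w | ∃ z, (w, z) ∈ K'} := by
    intro K' hK'
    convert (hK'.image continuous_fst).measurableSet using 1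
    ext y; simp
  let S : (ℕ → Bool) → Set ℝ≥0 := fun w => {t | ∃ e, (w, (t, e)) ∈ K}
  have hS : ∀ w, (∃ z, (w, z) ∈ K) → sInf (S w) ∈ S w := by
    rintro w ⟨⟨t, e⟩, h⟩
    have : S w = (fun q : (ℕ → Bool) × (ℝ≥0 × E) => q.2.1) '' (K ∩ Prod.fst ⁻¹' {w}) := by
      ext t
      constructor
      · rintro ⟨e, he⟩
        exact ⟨_, ⟨he, rfl⟩, rfl⟩
      · rintro ⟨⟨w', t', e⟩, ⟨he, rfl⟩, rfl⟩
        exact ⟨e, he⟩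
    have hc : IsCompact (S w) := by
      rw [this]
      exact (hK.inter_right (isClosed_singleton.preimage continuous_fst)).image
        (by fun_prop)
    exact hc.sInf_mem ⟨t, e, h⟩
  refine ⟨{y | ∃ z, (g y, z) ∈ K}, fun y => sInf (S (g y)), (hproj K hK).preimage hg, ?_, ?_, hle⟩
  · refine Measurable.comp (g := fun w => sInf (S w)) ?_ hg
    refine measurable_of_Iic fun a => ?_
    have : (fun w => sInf (S w)) ⁻¹' Iic a = {w | ∃ z, (w, z) ∈ K}ᶜ ∪
        {w | ∃ z, (w, z) ∈ K ∩ (fun q : (ℕ → Bool) × (ℝ≥0 × E) => q.2.1) ⁻¹' Iic a} := by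
      ext w
      constructor
      · intro hw
        by_cases h : ∃ z, (w, z) ∈ K
        · obtain ⟨e, he⟩ := hS w h
          exact Or.inr ⟨_, he, hw⟩
        · exact Or.inl h
      · rintro (h | ⟨⟨t, e⟩, h, ht⟩)
        · have : S w = ∅ := by
            ext t
            simp only [mem_empty_iff_false, iff_false]
            rintro ⟨e, he⟩
            exact h ⟨_, he⟩
          simp [this]
        · exact (csInf_le (OrderBot.bddBelow (S w)) (show t ∈ S w from ⟨e, h⟩)).trans ht
    rw [this]
    exact (hproj K hK).compl.union
      (hproj _ (hK.inter_right (isClosed_Iic.preimage (by fun_prop))))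
  · intro y hy
    obtain ⟨e, he⟩ := hS _ hy
    exact ⟨e, hKA _ _ he⟩

theorem Fbar_mono {s t : ℝ≥0} (h : s ≤ t) : Fbar s ≤ Fbar t := by
  refine sup_le_sup (biSup_mono fun u hu => le_trans hu h) (generateFrom_mono ?_)
  rintro A ⟨u, hu, rfl⟩
  exact ⟨u, hu.trans h, rfl⟩

theorem Fbar_le (t : ℝ≥0) : Fbar t ≤ (inferInstance : MeasurableSpace OmegaBar) := by
  refine sup_le (iSup₂_le fun u _ => ?_) (generateFrom_le ?_)
  · exact ((measurable_pi_apply u).comp measurable_fst).comap_le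
  · rintro A ⟨u, -, rfl⟩
    exact measurableSet_le measurable_snd measurable_const

namespace IsFbarStopping

variable {σ τ : OmegaBar → ℝ≥0∞}

theorem const (a : ℝ≥0∞) : IsFbarStopping fun _ => a := fun t => by
  let := Fbar t
  exact MeasurableSet.const _

theorem sup (hσ : IsFbarStopping σ) (hτ : IsFbarStopping τ) :
    IsFbarStopping fun x => σ x ⊔ τ x := fun t => by
  let := Fbar t
  simpa only [sup_le_iff, ofPred_and] using (hσ t).inter (hτ t)

theorem inf (hσ : IsFbarStopping σ) (hτ : IsFbarStopping τ) :
    IsFbarStopping fun x => σ x ⊓ τ x := fun t => by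
  let := Fbar t
  simpa only [inf_le_iff, ofPred_or] using (hσ t).union (hτ t)

theorem iSup {τ : ℕ → OmegaBar → ℝ≥0∞} (hτ : ∀ n, IsFbarStopping (τ n)) :
    IsFbarStopping fun x => ⨆ n, τ n x := fun t => by
  let := Fbar t
  simpa only [iSup_le_iff, ofPred_forall] using MeasurableSet.iInter fun n => hτ n t

theorem measurable (hτ : IsFbarStopping τ) : Measurable τ := by
  refine measurable_of_Iic fun a => ?_
  induction a with
  | top => simp
  | coe a => exact Fbar_le a _ (hτ a)

theorem measurable_min (hτ : IsFbarStopping τ) (t : ℝ≥0) :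
    Measurable[Fbar t] fun x => min (τ x) t := by
  let := Fbar t
  refine measurable_of_Iic fun a => ?_
  rcases le_or_gt (t : ℝ≥0∞) a with h | h
  · convert MeasurableSet.univ
    exact eq_univ_of_forall fun x => (min_le_right _ _).trans h
  · lift a to ℝ≥0 using h.ne_top
    have : (fun x => min (τ x) t) ⁻¹' Iic (a : ℝ≥0∞) = {x | τ x ≤ a} := by
      ext x; simp [h.not_ge]
    rw [this]
    exact Fbar_mono (ENNReal.coe_lt_coe.1 h).le _ (hτ a)

theorem measurableSet_le_and_le (hσ : IsFbarStopping σ) (hτ : IsFbarStopping τ) (t : ℝ≥0) :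
    MeasurableSet[Fbar t] {x | σ x ≤ τ x ∧ τ x ≤ t} := by
  let := Fbar t
  have : {x | σ x ≤ τ x ∧ τ x ≤ t} =
      {x | min (σ x) t ≤ min (τ x) t} ∩ ({x | σ x ≤ t} ∩ {x | τ x ≤ t}) := by
    ext x
    constructor
    · rintro ⟨h, h'⟩
      exact ⟨min_le_min_right _ h, h.trans h', h'⟩
    · rintro ⟨h, h', h''⟩
      simp only [mem_ofPred_eq] at h h' h''
      rw [min_eq_left h', min_eq_left h''] at h
      exact ⟨h, h''⟩
  rw [this]
  exact (measurableSet_le (hσ.measurable_min t) (hτ.measurable_min t)).inter ((hσ t).inter (hτ t))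

theorem measurableSet_lt_and_le (hσ : IsFbarStopping σ) (hτ : IsFbarStopping τ) (t : ℝ≥0) :
    MeasurableSet[Fbar t] {x | σ x < τ x ∧ σ x ≤ t} := by
  let := Fbar t
  have : {x | σ x < τ x ∧ σ x ≤ t} = {x | σ x ≤ t} \ {x | τ x ≤ σ x ∧ σ x ≤ t} := by
    ext x
    simp only [mem_ofPred_eq, mem_sdiff, not_and, ← not_le]
    tauto
  rw [this]
  exact (hσ t).diff (hτ.measurableSet_le_and_le hσ t)

open Classical in
/-- The restriction of a stopping time to a set of its past. -/
theorem restrict {G : Set OmegaBar}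
    (hG : ∀ t : ℝ≥0, MeasurableSet[Fbar t] {x | x ∈ G ∧ τ x ≤ t}) :
    IsFbarStopping fun x => if x ∈ G then τ x else ∞ := fun t => by
  convert hG t using 1
  ext x
  by_cases h : x ∈ G <;> simp [h]

/-- The value of an optional set at a finite stopping time is determined by the past. -/
theorem measurableSet_mem_and_le (hτ : IsFbarStopping τ) {B : Set (ℝ≥0 × OmegaBar)}
    (hB : MeasurableSet[OptionalSF] B) (t : ℝ≥0) :
    MeasurableSet[Fbar t] {x | ((τ x).toNNReal, x) ∈ B ∧ τ x ≤ t} := by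
  let := Fbar t
  induction B, hB using generateFrom_induction with
  | hC B hB =>
    obtain ⟨σ₁, σ₂, h₁, h₂, rfl⟩ := hB
    convert (h₁.measurableSet_le_and_le hτ t).inter (hτ.measurableSet_lt_and_le h₂ t) using 1
    ext x
    by_cases h : τ x ≤ t
    · simp [ENNReal.coe_toNNReal (ne_top_of_le_ne_top ENNReal.coe_ne_top h), h]
    · simp [h]
  | empty => simp
  | compl B _ ih =>
    convert (hτ t).diff ih using 1
    ext x
    simp only [mem_ofPred_eq, mem_sdiff, mem_compl_iff]
    tauto
  | iUnion B _ ih =>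
    convert MeasurableSet.iUnion ih using 1
    ext x
    simp

end IsFbarStopping

theorem OptionalSF_le : OptionalSF ≤ (inferInstance : MeasurableSpace (ℝ≥0 × OmegaBar)) := by
  refine generateFrom_le ?_
  rintro _ ⟨σ, τ, hσ, hτ, rfl⟩
  have ht : Measurable fun p : ℝ≥0 × OmegaBar => (p.1 : ℝ≥0∞) := by fun_prop
  exact (measurableSet_le (hσ.measurable.comp measurable_snd) ht).inter
    (measurableSet_lt ht (hτ.measurable.comp measurable_snd))

/-- Sets whose debut after any stopping time is a stopping time and is attained. -/
def HasAttainedDebuts (B : Set (ℝ≥0 × OmegaBar)) : Prop :=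
  ∀ σ, IsFbarStopping σ → ∃ τ, IsFbarStopping τ ∧ σ ≤ τ ∧
    (∀ x, τ x < ∞ → ((τ x).toNNReal, x) ∈ B) ∧
    ∀ (t : ℝ≥0) x, (t, x) ∈ B → σ x ≤ t → τ x ≤ t

namespace HasAttainedDebuts

theorem empty : HasAttainedDebuts ∅ := fun σ _ =>
  ⟨fun _ => ∞, .const _, fun _ => le_top, by simp, by simp⟩

theorem union {B C : Set (ℝ≥0 × OmegaBar)} (hB : HasAttainedDebuts B)
    (hC : HasAttainedDebuts C) : HasAttainedDebuts (B ∪ C) := by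
  intro σ hσ
  obtain ⟨τ₁, h₁, hle₁, hmem₁, hd₁⟩ := hB σ hσ
  obtain ⟨τ₂, h₂, hle₂, hmem₂, hd₂⟩ := hC σ hσ
  refine ⟨_, h₁.inf h₂, fun x => le_inf (hle₁ x) (hle₂ x), fun x hx => ?_, ?_⟩
  · rcases le_total (τ₁ x) (τ₂ x) with h | h
    · rw [inf_eq_left.2 h] at hx ⊢
      exact Or.inl (hmem₁ x hx)
    · rw [inf_eq_right.2 h] at hx ⊢
      exact Or.inr (hmem₂ x hx)
  · rintro t x (h | h) ht
    · exact inf_le_left.trans (hd₁ t x h ht)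
    · exact inf_le_right.trans (hd₂ t x h ht)

theorem stochasticInterval {σ τ : OmegaBar → ℝ≥0∞} (hσ : IsFbarStopping σ)
    (hτ : IsFbarStopping τ) :
    HasAttainedDebuts {p | σ p.2 ≤ (p.1 : ℝ≥0∞) ∧ (p.1 : ℝ≥0∞) < τ p.2} := by
  classical
  intro ρ hρ
  refine ⟨_, IsFbarStopping.restrict (G := {x | ρ x ⊔ σ x < τ x})
    fun t => (hρ.sup hσ).measurableSet_lt_and_le hτ t, fun x => ?_, fun x hx => ?_,
    fun t x h ht => ?_⟩
  · beta_reduce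
    split_ifs
    · exact le_sup_left
    · exact le_top
  · split_ifs at hx ⊢ with h
    · simp only [mem_ofPred_eq, ENNReal.coe_toNNReal hx.ne]
      exact ⟨le_sup_right, h⟩
    · exact absurd hx (lt_irrefl _)
  · have h' : ρ x ⊔ σ x ≤ t := sup_le ht h.1
    rwa [if_pos (show x ∈ {x | ρ x ⊔ σ x < τ x} from h'.trans_lt h.2)]

end HasAttainedDebuts

/-- Countable intersections of optional sets with attained debuts. -/
def IsDebutDelta (B : Set (ℝ≥0 × OmegaBar)) : Prop :=
  ∃ D : ℕ → Set (ℝ≥0 × OmegaBar),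
    (∀ n, HasAttainedDebuts (D n) ∧ MeasurableSet[OptionalSF] (D n)) ∧ B = ⋂ n, D n

namespace IsDebutDelta

theorem of_hasAttainedDebuts {B : Set (ℝ≥0 × OmegaBar)} (hB : HasAttainedDebuts B)
    (hm : MeasurableSet[OptionalSF] B) : IsDebutDelta B :=
  ⟨fun _ => B, fun _ => ⟨hB, hm⟩, (iInter_const B).symm⟩

theorem empty : IsDebutDelta ∅ :=
  of_hasAttainedDebuts .empty (@MeasurableSet.empty _ OptionalSF)

theorem measurableSet {B : Set (ℝ≥0 × OmegaBar)} (hB : IsDebutDelta B) :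
    MeasurableSet[OptionalSF] B := by
  obtain ⟨D, hD, rfl⟩ := hB
  exact @MeasurableSet.iInter _ _ OptionalSF _ _ fun n => (hD n).2

theorem iInter {B : ℕ → Set (ℝ≥0 × OmegaBar)} (hB : ∀ n, IsDebutDelta (B n)) :
    IsDebutDelta (⋂ n, B n) := by
  choose D hD h using hB
  refine ⟨fun k => D k.unpair.1 k.unpair.2, fun k => hD _ _, ?_⟩
  simp only [h]
  ext p
  simp only [mem_iInter]
  exact ⟨fun H k => H _ _, fun H n k => by simpa using H (Nat.pair n k)⟩

theorem union {B C : Set (ℝ≥0 × OmegaBar)} (hB : IsDebutDelta B) (hC : IsDebutDelta C) :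
    IsDebutDelta (B ∪ C) := by
  obtain ⟨D, hD, rfl⟩ := hB
  obtain ⟨D', hD', rfl⟩ := hC
  rw [iInter_union_iInter]
  refine ⟨fun k => D k.unpair.1 ∪ D' k.unpair.2, fun k => ⟨(hD _).1.union (hD' _).1,
    @MeasurableSet.union _ OptionalSF _ _ (hD _).2 (hD' _).2⟩, ?_⟩
  ext p
  simp only [mem_iInter]
  exact ⟨fun H k => H _ _, fun H n k => by simpa using H (Nat.pair n k)⟩

theorem accumulate {B : ℕ → Set (ℝ≥0 × OmegaBar)} (hB : ∀ n, IsDebutDelta (B n)) (n : ℕ) :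
    IsDebutDelta (Set.accumulate B n) := by
  induction n with
  | zero => simpa using hB 0
  | succ n ih => simpa [Set.accumulate_succ] using ih.union (hB (n + 1))

/-- A countable intersection of optional sets with attained debuts admits an almost sure section:
the largest stopping time below its debut. -/
theorem exists_section (P : Measure OmegaBar) [IsProbabilityMeasure P]
    {B : Set (ℝ≥0 × OmegaBar)} (hB : IsDebutDelta B) :
    ∃ τ, IsFbarStopping τ ∧ (∀ x, τ x < ∞ → ((τ x).toNNReal, x) ∈ B) ∧
      P {x | ∃ t, (t, x) ∈ B} ≤ P {x | τ x < ∞} := by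
  classical
  let 𝒞 : Set (OmegaBar → ℝ≥0∞) :=
    {σ | IsFbarStopping σ ∧ ∀ (t : ℝ≥0) x, (t, x) ∈ B → σ x ≤ t}
  let Φ : (OmegaBar → ℝ≥0∞) → ℝ≥0∞ := fun σ => ∫⁻ x, (1 + σ x)⁻¹ ∂P
  have hΦ : ∀ σ τ : OmegaBar → ℝ≥0∞, σ ≤ τ → Φ τ ≤ Φ σ := fun σ τ h =>
    lintegral_mono fun x => ENNReal.inv_le_inv.2 (by gcongr; exact h x)
  have hne : (Φ '' 𝒞).Nonempty := ⟨_, _, ⟨.const 0, fun _ _ _ => zero_le⟩, rfl⟩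
  obtain ⟨u, -, hu, huC⟩ := exists_seq_tendsto_sInf hne (OrderBot.bddBelow _)
  choose s hs hsu using huC
  let S : OmegaBar → ℝ≥0∞ := fun x => ⨆ n, s n x
  have hS : IsFbarStopping S := .iSup fun n => (hs n).1
  have hSB : ∀ (t : ℝ≥0) x, (t, x) ∈ B → S x ≤ t := fun t x h => iSup_le fun n => (hs n).2 t x h
  have hΦS : Φ S ≤ sInf (Φ '' 𝒞) := ge_of_tendsto' hu fun n => by
    rw [← hsu n]
    exact hΦ _ _ fun x => le_iSup (fun n => s n x) n
  have hmem : ∀ᵐ x ∂P, S x < ∞ → ((S x).toNNReal, x) ∈ B := by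
    obtain ⟨D, hD, rfl⟩ := hB
    simp only [mem_iInter]
    have : ∀ n, ∀ᵐ x ∂P, S x < ∞ → ((S x).toNNReal, x) ∈ D n := by
      intro n
      obtain ⟨τ, hτ, hle, hτD, hd⟩ := (hD n).1 S hS
      have hτC : τ ∈ 𝒞 := ⟨hτ, fun t x h => hd t x (mem_iInter.1 h n) (hSB t x h)⟩
      have heq : (fun x => (1 + τ x)⁻¹) =ᵐ[P] fun x => (1 + S x)⁻¹ := by
        refine ae_eq_of_ae_le_of_lintegral_le
          (Filter.Eventually.of_forall fun x => ENNReal.inv_le_inv.2 (by gcongr; exact hle x)) ?_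
          (hS.measurable.const_add 1).inv.aemeasurable (hΦS.trans (csInf_le' ⟨τ, hτC, rfl⟩))
        refine ne_top_of_le_ne_top ENNReal.one_ne_top
          ((lintegral_mono (g := fun _ => 1) fun x => ?_).trans (by simp))
        exact ENNReal.inv_le_one.2 le_self_add
      filter_upwards [heq] with x hx hfin
      have hx' : τ x = S x :=
        (ENNReal.add_right_inj ENNReal.one_ne_top).1 (inv_injective hx)
      rw [← hx'] at hfin ⊢
      exact hτD x hfin
    filter_upwards [ae_all_iff.2 this] with x hx hfin n using hx n hfin
  refine ⟨_, IsFbarStopping.restrict (G := {x | ((S x).toNNReal, x) ∈ B})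
    fun t => hS.measurableSet_mem_and_le hB.measurableSet t, fun x hx => ?_, ?_⟩
  · split_ifs at hx ⊢ with h
    · exact h
    · exact absurd hx (lt_irrefl _)
  · refine measure_mono_ae ?_
    filter_upwards [hmem] with x hx
    rintro ⟨t, ht⟩
    have hfin : S x < ∞ := (hSB t x ht).trans_lt ENNReal.coe_lt_top
    change (if x ∈ {x | ((S x).toNNReal, x) ∈ B} then S x else ∞) < ∞
    rwa [if_pos (show x ∈ {x | ((S x).toNNReal, x) ∈ B} from hx hfin)]

/-- Inner approximation of optional sets, for a measure carried by a random time. -/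
theorem exists_subset_measure_diff_le {P : Measure OmegaBar} [IsFiniteMeasure P]
    {φ : OmegaBar → ℝ≥0 × OmegaBar} (hφ : Measurable φ) {C : Set (ℝ≥0 × OmegaBar)}
    (hC : MeasurableSet[OptionalSF] C) {ε : ℝ≥0∞} (hε : ε ≠ 0) :
    ∃ B ⊆ C, IsDebutDelta B ∧ P (φ ⁻¹' (C \ B)) ≤ ε := by
  have hφ' : ∀ {B}, MeasurableSet[OptionalSF] B → MeasurableSet (φ ⁻¹' B) :=
    fun hB => (OptionalSF_le _ hB).preimage hφ
  suffices ∀ ε : ℝ≥0∞, ε ≠ 0 → (∃ B ⊆ C, IsDebutDelta B ∧ P (φ ⁻¹' (C \ B)) ≤ ε) ∧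
      ∃ B ⊆ Cᶜ, IsDebutDelta B ∧ P (φ ⁻¹' (Cᶜ \ B)) ≤ ε from (this ε hε).1
  clear hε ε
  induction C, hC using generateFrom_induction with
  | hC C hC hCm =>
    intro ε _
    obtain ⟨σ, τ, hσ, hτ, rfl⟩ := hC
    refine ⟨⟨_, Subset.rfl, of_hasAttainedDebuts (.stochasticInterval hσ hτ) hCm, by simp⟩,
      ⟨_, Subset.rfl, of_hasAttainedDebuts ?_ (@MeasurableSet.compl _ _ OptionalSF hCm), by simp⟩⟩
    convert (HasAttainedDebuts.stochasticInterval (.const 0) hσ).union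
      (.stochasticInterval hτ (.const ∞)) using 1
    ext p
    simp only [mem_compl_iff, mem_ofPred_eq, not_and_or, not_le, not_lt, mem_union, zero_le,
      true_and, ENNReal.coe_lt_top, and_true]
  | empty =>
    refine fun ε _ => ⟨⟨∅, Subset.rfl, empty, by simp⟩, ⟨univ, by simp, ?_, by simp⟩⟩
    refine of_hasAttainedDebuts ?_ (@MeasurableSet.univ _ OptionalSF)
    convert HasAttainedDebuts.stochasticInterval (.const 0) (.const ∞)
    ext p; simp
  | compl C _ ih =>
    intro ε hε
    rw [compl_compl]
    exact (ih ε hε).symm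
  | iUnion C hCm ih =>
    intro ε hε
    constructor
    · obtain ⟨δ, hδ, hδε⟩ := ENNReal.exists_pos_sum_of_countable' (ENNReal.half_pos hε).ne' ℕ
      choose B hBC hB hBδ using fun n => (ih n (δ n) (hδ n).ne').1
      have hanti : Antitone fun n => φ ⁻¹' ((⋃ k, C k) \ Set.accumulate B n) := fun m n h =>
        preimage_mono (sdiff_subset_sdiff_right (monotone_accumulate h))
      have hlim := tendsto_measure_iInter_atTop (μ := P)
        (fun n => (hφ' (@MeasurableSet.diff _ OptionalSF _ _
          (@MeasurableSet.iUnion _ _ OptionalSF _ _ hCm)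
          (accumulate hB n).measurableSet)).nullMeasurableSet) hanti ⟨0, measure_ne_top _ _⟩
      have hlt : P (⋂ n, φ ⁻¹' ((⋃ k, C k) \ Set.accumulate B n)) < ε ∨ ε = ∞ := by
        rw [or_iff_not_imp_right]
        intro hεt
        refine lt_of_le_of_lt ?_ (ENNReal.half_lt_self hε hεt)
        refine le_trans ?_ hδε.le
        refine le_trans (measure_mono ?_) ((measure_iUnion_le fun n => φ ⁻¹' (C n \ B n)).trans
          (ENNReal.tsum_le_tsum hBδ))
        intro x hx
        simp only [mem_iInter, mem_preimage, mem_sdiff, mem_iUnion, mem_accumulate] at hx ⊢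
        obtain ⟨k, hk⟩ := (hx 0).1
        exact ⟨k, hk, fun h => (hx k).2 ⟨k, le_rfl, h⟩⟩
      rcases hlt with hlt | rfl
      · obtain ⟨n, hn⟩ := (hlim.eventually (gt_mem_nhds hlt)).exists
        refine ⟨_, ?_, accumulate hB n, hn.le⟩
        exact (accumulate_subset_iUnion n).trans (iUnion_mono hBC)
      · exact ⟨∅, empty_subset _, empty, le_top⟩
    · obtain ⟨δ, hδ, hδε⟩ := ENNReal.exists_pos_sum_of_countable' hε ℕ
      choose B hBC hB hBδ using fun n => (ih n (δ n) (hδ n).ne').2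
      refine ⟨⋂ n, B n, ?_, iInter hB, ?_⟩
      · rw [compl_iUnion]
        exact iInter_mono hBC
      · refine le_trans (measure_mono ?_) ((measure_iUnion_le fun n => φ ⁻¹' ((C n)ᶜ \ B n)).trans
          ((ENNReal.tsum_le_tsum hBδ).trans hδε.le))
        intro x hx
        simp only [mem_preimage, mem_sdiff, mem_iUnion, mem_compl_iff, mem_iInter, not_exists,
          not_forall] at hx ⊢
        obtain ⟨h, n, hn⟩ := hx
        exact ⟨n, h n, hn⟩

end IsDebutDelta

/-- measurable (optional cross-)section with auxiliary Lusin parameter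
space: for `P̄` a probability on `Ω̄`, `(E, ℰ)` Lusin (standard Borel), and
`A ⊆ ℝ₊ × Ω̄ × E` measurable w.r.t. `Ō ⊗ ℰ`, for every `ε > 0` there is an
`F̄`-stopping time `τ` with `P̄[τ < ∞] ≥ P̄[Π₂(A)] − ε` and `(τ(ω̄), ω̄) ∈ Π₁₂(A)`
whenever `τ(ω̄) < ∞`. -/
theorem optional_cross_section
    {E : Type*} [MeasurableSpace E] [StandardBorelSpace E]
    (P : Measure OmegaBar) [IsProbabilityMeasure P]
    (A : Set ((ℝ≥0 × OmegaBar) × E))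
    (hA : MeasurableSet[OptionalSF.prod (inferInstance : MeasurableSpace E)] A)
    (ε : ℝ≥0∞) (hε : 0 < ε) :
    ∃ τ : OmegaBar → ℝ≥0∞, IsFbarStopping τ ∧
      P {x | τ x < ∞} ≥ P {x : OmegaBar | ∃ (t : ℝ≥0) (e : E), ((t, x), e) ∈ A} - ε ∧
      ∀ x : OmegaBar, τ x < ∞ → ∃ e : E, (((τ x).toNNReal, x), e) ∈ A := by
  have hδ : ε / 3 ≠ 0 := (ENNReal.div_pos hε.ne' (by simp)).ne'
  have hA' : MeasurableSet A :=
    sup_le_sup (MeasurableSpace.comap_mono OptionalSF_le) le_rfl _ hA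
  let ψ : OmegaBar × (ℝ≥0 × E) → (ℝ≥0 × OmegaBar) × E := fun q => ((q.2.1, q.1), q.2.2)
  have hψ : Measurable ψ := by fun_prop
  obtain ⟨C₀, R, -, hR, hRA, hle₀⟩ := (hA'.preimage hψ).exists_measurable_section P hδ
  let φ : OmegaBar → ℝ≥0 × OmegaBar := fun x => (R x, x)
  have hφ : Measurable φ := hR.prodMk measurable_id
  obtain ⟨C, hC, hCA, hle₁⟩ := @MeasurableSet.exists_measurableSet_measure_proj_le _ _ _ _ OptionalSF
    _ _ (P.restrict C₀) _ φ (hφ.mono le_rfl OptionalSF_le) A hA _ hδ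
  obtain ⟨B, hBC, hB, hle₂⟩ :=
    IsDebutDelta.exists_subset_measure_diff_le (P := P.restrict C₀) hφ hC hδ
  obtain ⟨τ, hτ, hτB, hle₃⟩ := hB.exists_section P
  have hle₄ : P.restrict C₀ (φ ⁻¹' B) ≤ P {x | τ x < ∞} :=
    (Measure.restrict_apply_le _ _).trans
      ((measure_mono fun x (hx : φ x ∈ B) => show ∃ t, (t, x) ∈ B from ⟨R x, hx⟩).trans hle₃)
  refine ⟨τ, hτ, ?_, fun x hx => hCA _ (hBC (hτB x hx))⟩
  rw [ge_iff_le, tsub_le_iff_right]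
  calc P {x | ∃ (t : ℝ≥0) (e : E), ((t, x), e) ∈ A}
      ≤ P {x | ∃ z, (x, z) ∈ ψ ⁻¹' A} :=
        measure_mono fun x ⟨t, e, h⟩ => ⟨(t, e), h⟩
    _ ≤ P C₀ + ε / 3 := hle₀
    _ = P.restrict C₀ C₀ + ε / 3 := by rw [Measure.restrict_apply_self]
    _ ≤ P.restrict C₀ {x | ∃ e, (φ x, e) ∈ A} + ε / 3 := by
        gcongr
        exact hRA
    _ ≤ P.restrict C₀ (φ ⁻¹' C) + ε / 3 + ε / 3 := by gcongr
    _ ≤ P.restrict C₀ (φ ⁻¹' B) + P.restrict C₀ (φ ⁻¹' (C \ B)) + ε / 3 + ε / 3 := by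
        gcongr
        refine (measure_mono ?_).trans (measure_union_le _ _)
        rw [← preimage_union, union_sdiff_cancel hBC]
    _ ≤ P {x | τ x < ∞} + ε / 3 + ε / 3 + ε / 3 := by
        exact add_le_add_left (add_le_add_left (add_le_add hle₄ hle₂) _) _
    _ = P {x | τ x < ∞} + ε := by
        rw [add_assoc, add_assoc, ← add_assoc (ε / 3), ENNReal.add_thirds]
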